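/- arXiv:1412.1519 — 2 statements merged into one kernel-verified Lean document; each statement's English description precedes it below -/
import Mathlib

section
/- Let μ be a probability measure on ℝ with support contained in [−R, R] (R > 0). With p(t) = (2π)^{-1/2} exp(−t²/2), q(t) = ∫_{[−R,R]} p(t−s) dμ(s), Λ(x) = ∫_{[−R,R]} e^{xs} dμ(s), and K(x) = (log Λ(x) + R)/x, we have for all x ≥ 2R: exp(−2R² − 2R − 1/8)·p(x) ≤ q(x + K(x)) ≤ e^{−R}·p(x). -/
open MeasureTheory Real Filter

/-- The standard Gaussian density `p(t) = (2π)^{-1/2} exp(−t²/2)`. -/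
noncomputable def stdp (t : ℝ) : ℝ := (2 * π) ^ (-(1 : ℝ) / 2) * Real.exp (-t ^ 2 / 2)

/-- `q(t) = ∫_{[−R,R]} p(t−s) dμ(s)`, the density of `μ ∗ γ₁`. -/
noncomputable def qdens (μ : Measure ℝ) (R : ℝ) (t : ℝ) : ℝ :=
  ∫ s in Set.Icc (-R) R, stdp (t - s) ∂μ

/-- `Λ(x) = ∫_{[−R,R]} e^{xs} dμ(s)`. -/
noncomputable def Lam (μ : Measure ℝ) (R : ℝ) (x : ℝ) : ℝ :=
  ∫ s in Set.Icc (-R) R, Real.exp (x * s) ∂μ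

/-- `K(x) = (log Λ(x) + R) / x`. -/
noncomputable def Kfun (μ : Measure ℝ) (R : ℝ) (x : ℝ) : ℝ :=
  (Real.log (Lam μ R x) + R) / x

/-- `F`, the cumulative distribution function of the standard Gaussian `γ₁`. -/
noncomputable def Fcdf (x : ℝ) : ℝ := ∫ t in Set.Iic x, stdp t

/-- `G`, the cumulative distribution function of `μ ∗ γ₁`. -/
noncomputable def Gcdf (μ : Measure ℝ) (R : ℝ) (x : ℝ) : ℝ :=
  ∫ t in Set.Iic x, qdens μ R t

theorem stmt7 (μ : Measure ℝ) [IsProbabilityMeasure μ] (R : ℝ) (hR : 0 < R)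
    (hsupp : μ (Set.Icc (-R) R)ᶜ = 0) :
    ∀ x : ℝ, 2 * R ≤ x →
      Real.exp (-2 * R ^ 2 - 2 * R - 1 / 8) * stdp x ≤ qdens μ R (x + Kfun μ R x) ∧
      qdens μ R (x + Kfun μ R x) ≤ Real.exp (-R) * stdp x := by
  intro x hx
  have hx0 : 0 < x := by linarith
  have hI : μ.real (Set.Icc (-R) R) = 1 := by
    have h := (prob_compl_eq_zero_iff (μ := μ) (measurableSet_Icc (a := -R) (b := R))).1 hsupp
    simp [Measure.real, h]
  have hcont : ∀ f : ℝ → ℝ, Continuous f → IntegrableOn f (Set.Icc (-R) R) μ :=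
    fun f hf => hf.continuousOn.integrableOn_compact isCompact_Icc
  have hint := hcont (fun s => Real.exp (x * s)) (by fun_prop)
  have hlo : Real.exp (-(x * R)) ≤ Lam μ R x := by
    have h := setIntegral_mono_on (hcont (fun _ => Real.exp (-(x * R))) continuous_const) hint
      measurableSet_Icc (fun s hs => Real.exp_le_exp.2 (by nlinarith [hs.1]))
    simpa [hI, Lam] using h
  have hhi : Lam μ R x ≤ Real.exp (x * R) := by
    have h := setIntegral_mono_on hint (hcont (fun _ => Real.exp (x * R)) continuous_const)
      measurableSet_Icc (fun s hs => Real.exp_le_exp.2 (by nlinarith [hs.2]))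
    simpa [hI, Lam] using h
  have hpos : 0 < Lam μ R x := lt_of_lt_of_le (Real.exp_pos _) hlo
  have hL1 : -(x * R) ≤ Real.log (Lam μ R x) := (Real.le_log_iff_exp_le hpos).2 hlo
  have hL2 : Real.log (Lam μ R x) ≤ x * R := (Real.log_le_iff_le_exp hpos).2 hhi
  have hKx : Kfun μ R x * x = Real.log (Lam μ R x) + R := by
    unfold Kfun; field_simp
  have hK1 : -R ≤ Kfun μ R x := by
    unfold Kfun; rw [le_div_iff₀ hx0]; nlinarith
  have hK2 : Kfun μ R x ≤ R + 1 / 2 := by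
    unfold Kfun; rw [div_le_iff₀ hx0]; nlinarith
  set K := Kfun μ R x with hK
  set L := Real.log (Lam μ R x) with hL
  have hexpL : Real.exp L = Lam μ R x := Real.exp_log hpos
  have hc : 0 < (2 * π) ^ (-(1 : ℝ) / 2) := by positivity
  have hqint := hcont (fun s => stdp (x + K - s)) (by unfold stdp; fun_prop)
  have key : ∀ B : ℝ, ∫ s in Set.Icc (-R) R, (Real.exp (B - L) * stdp x) * Real.exp (x * s) ∂μ
      = Real.exp B * stdp x := by
    intro B
    rw [integral_const_mul]
    change _ * Lam μ R x = _
    rw [← hexpL, Real.exp_sub]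
    field_simp
  constructor
  · rw [← key]
    refine setIntegral_mono_on (hint.const_mul _) hqint measurableSet_Icc (fun s hs => ?_)
    have : -2 * R ^ 2 - 2 * R - 1 / 8 - L + -x ^ 2 / 2 + x * s ≤ -(x + K - s) ^ 2 / 2 := by
      nlinarith [hs.1, hs.2, mul_nonneg (show 0 ≤ 2 * R + 1 / 2 - (K - s) by linarith [hs.1])
        (show 0 ≤ 2 * R + 1 / 2 + (K - s) by linarith [hs.2])]
    have h := mul_le_mul_of_nonneg_left (Real.exp_le_exp.2 this) hc.le
    rw [Real.exp_add, Real.exp_add] at h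
    unfold stdp
    linarith
  · rw [← key]
    refine setIntegral_mono_on hqint (hint.const_mul _) measurableSet_Icc (fun s hs => ?_)
    have : -(x + K - s) ^ 2 / 2 ≤ -R - L + -x ^ 2 / 2 + x * s := by
      nlinarith [sq_nonneg (K - s)]
    have h := mul_le_mul_of_nonneg_left (Real.exp_le_exp.2 this) hc.le
    rw [Real.exp_add, Real.exp_add] at h
    unfold stdp
    linarith
end

section
/- Let μ be a probability measure on ℝ with support contained in [−R, R] (R > 0). Let F and G be the cumulative distribution functions of the standard Gaussian γ_1 and of μ*γ_1 respectively, and let K(x) = (log Λ(x) + R)/x with Λ(x) = ∫_{[−R,R]} e^{xs} dμ(s). Then for all x ≥ 2R: x − R ≤ (G⁻¹∘F)(x) ≤ x + K(x). -/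
open MeasureTheory Real Filter

theorem stdp_pos (t : ℝ) : 0 < stdp t := by unfold stdp; positivity

theorem stdp_cont : Continuous stdp := by unfold stdp; fun_prop

theorem stdp_int : Integrable stdp := by
  have h := (integrable_exp_neg_mul_sq (b := 1 / 2) (by norm_num)).const_mul
    ((2 * π) ^ (-(1 : ℝ) / 2))
  refine h.congr (ae_of_all _ fun t => ?_)
  simp only [stdp]
  congr 2
  ring

theorem stdp_deriv (t : ℝ) : HasDerivAt stdp (-t * stdp t) t := by
  have h1 : HasDerivAt (fun t : ℝ => -t ^ 2 / 2) (-t) t := by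
    have := ((hasDerivAt_pow 2 t).neg).div_const 2
    refine HasDerivAt.congr_deriv this ?_
    norm_num
    ring
  have := (h1.exp).const_mul ((2 * π) ^ (-(1 : ℝ) / 2))
  refine HasDerivAt.congr_deriv this ?_
  simp only [stdp]
  ring

theorem stdp_shift (t u : ℝ) : stdp (t + u) = stdp t * Real.exp (-t * u - u ^ 2 / 2) := by
  simp only [stdp]
  rw [mul_assoc, ← Real.exp_add]
  congr 2
  ring

theorem Fcdf_deriv (x : ℝ) : HasDerivAt Fcdf (stdp x) x := by
  have h : Fcdf = fun y => Fcdf 0 + ∫ t in (0 : ℝ)..y, stdp t := by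
    funext y
    rw [← intervalIntegral.integral_Iic_sub_Iic stdp_int.integrableOn stdp_int.integrableOn]
    simp only [Fcdf]
    ring
  rw [h]
  exact (intervalIntegral.integral_hasDerivAt_right (stdp_cont.intervalIntegrable _ _)
    (stdp_cont.stronglyMeasurableAtFilter _ _) stdp_cont.continuousAt).const_add _

theorem Fcdf_strictMono : StrictMono Fcdf := by
  refine strictMono_of_deriv_pos fun x => ?_
  rw [(Fcdf_deriv x).deriv]
  exact stdp_pos x

theorem Fcdf_cont : Continuous Fcdf :=
  continuous_iff_continuousAt.2 fun x => (Fcdf_deriv x).continuousAt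

noncomputable def Ctot : ℝ := ∫ t, stdp t

noncomputable def Qtail (x : ℝ) : ℝ := Ctot - Fcdf x

theorem Qtail_deriv (x : ℝ) : HasDerivAt Qtail (-stdp x) x := (Fcdf_deriv x).const_sub _

theorem Qtail_tendsto : Tendsto Qtail atTop (nhds 0) := by
  have h : Tendsto Fcdf atTop (nhds Ctot) := by
    have := (aecover_Iic (μ := volume) (tendsto_id (α := ℝ) (x := atTop))).integral_tendsto_of_countably_generated stdp_int
    exact this
  have := h.const_sub Ctot
  rw [sub_self] at this
  exact this

theorem nonneg_of_deriv (f f' : ℝ → ℝ) (x : ℝ) (hd : ∀ y, HasDerivAt f (f' y) y)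
    (hf : ∀ y, x ≤ y → f' y ≤ 0) (ht : Tendsto f atTop (nhds 0)) : 0 ≤ f x := by
  have hanti : AntitoneOn f (Set.Ici x) := by
    refine antitoneOn_of_deriv_nonpos (convex_Ici x)
      (fun y _ => (hd y).continuousAt.continuousWithinAt)
      (fun y _ => (hd y).differentiableAt.differentiableWithinAt) fun y hy => ?_
    rw [(hd y).deriv]
    rw [interior_Ici] at hy
    exact hf y (le_of_lt hy)
  refine le_of_tendsto ht ?_
  filter_upwards [eventually_ge_atTop x] with y hy
  exact hanti Set.self_mem_Ici hy hy

theorem Qtail_pos (x : ℝ) : 0 < Qtail x := by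
  have h1 : 0 ≤ Qtail (x + 1) :=
    nonneg_of_deriv Qtail (fun y => -stdp y) (x + 1) Qtail_deriv
      (fun y _ => by have := stdp_pos y; linarith) Qtail_tendsto
  have h2 := Fcdf_strictMono (show x < x + 1 by linarith)
  unfold Qtail at *
  linarith

theorem stdp_tendsto : Tendsto stdp atTop (nhds 0) := by
  have h : Tendsto (fun t : ℝ => -t ^ 2 / 2) atTop atBot := by
    have : Tendsto (fun t : ℝ => t ^ 2 / 2) atTop atTop :=
      (tendsto_pow_atTop two_ne_zero).atTop_div_const (by norm_num)
    refine (tendsto_neg_atTop_atBot.comp this).congr fun t => ?_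
    simp only [Function.comp]
    ring
  have := (Real.tendsto_exp_atBot.comp h).const_mul ((2 * π) ^ (-(1 : ℝ) / 2))
  rw [mul_zero] at this
  exact this

theorem mills (x : ℝ) : stdp x * (x / (x ^ 2 + 1)) ≤ Qtail x := by
  have h := nonneg_of_deriv (fun y => Qtail y - stdp y * (y / (y ^ 2 + 1)))
    (fun y => - stdp y * (2 / (y ^ 2 + 1) ^ 2)) x ?_ ?_ ?_
  · linarith
  · intro y
    have hne : y ^ 2 + 1 ≠ 0 := by positivity
    have h1 : HasDerivAt (fun y : ℝ => y ^ 2 + 1) (2 * y) y := by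
      have := (hasDerivAt_pow 2 y).add_const 1
      refine HasDerivAt.congr_deriv this ?_
      norm_num
    have h2 := (hasDerivAt_id y).div h1 hne
    have h3 := (Qtail_deriv y).sub ((stdp_deriv y).mul h2)
    refine HasDerivAt.congr_deriv h3 ?_
    simp only [id, Pi.div_apply]
    field_simp
    ring
  · intro y _
    have := stdp_pos y
    have : 0 ≤ stdp y * (2 / (y ^ 2 + 1) ^ 2) := by positivity
    linarith
  · have h1 : Tendsto (fun y => stdp y * (y / (y ^ 2 + 1))) atTop (nhds 0) := by
      refine squeeze_zero_norm (fun y => ?_) stdp_tendsto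
      rw [norm_mul, Real.norm_of_nonneg (stdp_pos y).le]
      refine mul_le_of_le_one_right (stdp_pos y).le ?_
      rw [Real.norm_eq_abs, abs_div, abs_of_pos (show 0 < y ^ 2 + 1 by positivity),
        div_le_one (by positivity)]
      exact abs_le.2 ⟨by nlinarith [sq_nonneg (y + 1)], by nlinarith [sq_nonneg (y - 1)]⟩
    simpa using Qtail_tendsto.sub h1

theorem Q_up (x u : ℝ) (hu : 0 ≤ u) : Qtail (x + u) ≤ Qtail x * Real.exp (-x * u) := by
  have h := nonneg_of_deriv (fun y => Qtail y * Real.exp (-x * u) - Qtail (y + u))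
    (fun y => -stdp y * Real.exp (-x * u) - -stdp (y + u)) x ?_ ?_ ?_
  · linarith
  · intro y
    exact ((Qtail_deriv y).mul_const _).sub ((Qtail_deriv (y + u)).comp_add_const y u)
  · intro y hy
    rw [stdp_shift]
    have : Real.exp (-y * u - u ^ 2 / 2) ≤ Real.exp (-x * u) :=
      Real.exp_le_exp.2 (by nlinarith [sq_nonneg u, mul_nonneg (sub_nonneg.2 hy) hu])
    nlinarith [stdp_pos y]
  · have h1 := Qtail_tendsto.comp (tendsto_atTop_add_const_right atTop u tendsto_id)
    simpa using (Qtail_tendsto.mul_const (Real.exp (-x * u))).sub h1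

theorem Q_down (x v : ℝ) (hx : 0 < x) (hv : 0 ≤ v) :
    Qtail (x - v) ≤ Qtail x * Real.exp (v * (x + 1 / x)) := by
  set c := x + 1 / x with hc
  have hcx : x < c := by rw [hc]; have : 0 < 1 / x := by positivity
                         linarith
  -- hazard bound at and below x
  have hx0 : stdp x ≤ c * Qtail x := by
    have h := mills x
    have hc0 : 0 < c := hx.trans hcx
    have h2 := mul_le_mul_of_nonneg_left h hc0.le
    have h3 : c * (stdp x * (x / (x ^ 2 + 1))) = stdp x := by
      rw [hc]; field_simp
    linarith
  have hg : AntitoneOn (fun y => c * Qtail y - stdp y) (Set.Iic x) := by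
    have hd : ∀ y, HasDerivAt (fun y => c * Qtail y - stdp y) (c * (-stdp y) - (-y * stdp y)) y :=
      fun y => ((Qtail_deriv y).const_mul c).sub (stdp_deriv y)
    refine antitoneOn_of_deriv_nonpos (convex_Iic x)
      (fun y _ => (hd y).continuousAt.continuousWithinAt)
      (fun y _ => (hd y).differentiableAt.differentiableWithinAt) fun y hy => ?_
    rw [(hd y).deriv]
    rw [interior_Iic] at hy
    have hy' : y < x := hy
    nlinarith [stdp_pos y]
  have hy : ∀ y, y ≤ x → stdp y ≤ c * Qtail y := fun y hy => by
    have : c * Qtail x - stdp x ≤ c * Qtail y - stdp y := hg hy Set.self_mem_Iic hy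
    linarith
  have hd : ∀ y, HasDerivAt (fun y => Qtail y * Real.exp (y * c))
      (-stdp y * Real.exp (y * c) + Qtail y * (Real.exp (y * c) * (1 * c))) y :=
    fun y => (Qtail_deriv y).mul (((hasDerivAt_id y).mul_const c).exp)
  have hm : MonotoneOn (fun y => Qtail y * Real.exp (y * c)) (Set.Iic x) := by
    refine monotoneOn_of_deriv_nonneg (convex_Iic x)
      (fun y _ => (hd y).continuousAt.continuousWithinAt)
      (fun y _ => (hd y).differentiableAt.differentiableWithinAt) fun y hy' => ?_
    rw [(hd y).deriv]
    rw [interior_Iic] at hy'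
    have := hy y (le_of_lt hy')
    have := Real.exp_pos (y * c)
    nlinarith
  have h : Qtail (x - v) * Real.exp ((x - v) * c) ≤ Qtail x * Real.exp (x * c) :=
    hm (show x - v ≤ x by linarith) Set.self_mem_Iic (by linarith)
  have e : Real.exp (x * c) = Real.exp (v * c) * Real.exp ((x - v) * c) := by
    rw [← Real.exp_add]; congr 1; ring
  rw [e, ← mul_assoc] at h
  exact le_of_mul_le_mul_right h (Real.exp_pos _)

theorem Q_key (R x D s : ℝ) (hR : 0 < R) (hx : 0 < x) (hD : -R + R / x ≤ D)
    (hs : s ≤ R) : Qtail (x + D - s) ≤ Qtail x * Real.exp (-x * (D - s) + R) := by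
  have hQ := (Qtail_pos x).le
  rcases le_total s D with h | h
  · have h1 := Q_up x (D - s) (by linarith)
    rw [← add_sub_assoc] at h1
    refine h1.trans (mul_le_mul_of_nonneg_left (Real.exp_le_exp.2 (by linarith)) hQ)
  · have h1 := Q_down x (s - D) hx (by linarith)
    rw [show x - (s - D) = x + D - s by ring] at h1
    refine h1.trans (mul_le_mul_of_nonneg_left (Real.exp_le_exp.2 ?_) hQ)
    have h2 : s - D ≤ 2 * R - R / x := by linarith
    have h3 : (s - D) * (1 / x) ≤ R := by
      calc (s - D) * (1 / x) ≤ (2 * R - R / x) * (1 / x) :=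
            mul_le_mul_of_nonneg_right h2 (by positivity)
        _ = R - R * (1 - 1 / x) ^ 2 := by ring
        _ ≤ R := by nlinarith [mul_nonneg hR.le (sq_nonneg (1 - 1 / x))]
    linarith

theorem Gcdf_eq (μ : Measure ℝ) [IsProbabilityMeasure μ] (R y : ℝ) :
    Gcdf μ R y = ∫ s in Set.Icc (-R) R, Fcdf (y - s) ∂μ := by
  unfold Gcdf qdens
  rw [integral_integral_swap]
  · congr 1
    funext s
    have h := (measurePreserving_sub_right volume s).setIntegral_preimage_emb
      (MeasurableEquiv.subRight s).measurableEmbedding stdp (Set.Iic (y - s))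
    rw [Fcdf, ← h]
    congr 2
    ext t
    simp
  · have hI : Integrable (Function.uncurry fun t s => stdp (t - s))
        (volume.prod (μ.restrict (Set.Icc (-R) R))) := by
      rw [integrable_prod_iff']
      · refine ⟨ae_of_all _ fun s => stdp_int.comp_sub_right s, ?_⟩
        have : ∀ s : ℝ, ∫ t, ‖Function.uncurry (fun t s => stdp (t - s)) (t, s)‖ = ∫ t, ‖stdp t‖ :=
          fun s => integral_sub_right_eq_self (fun t => ‖stdp t‖) s
        simp only [this]
        exact integrable_const _
      · have : Continuous (Function.uncurry fun t s => stdp (t - s)) :=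
          stdp_cont.comp (continuous_fst.sub continuous_snd)
        exact this.aestronglyMeasurable
    refine hI.mono_measure ?_
    exact Measure.prod_mono Measure.restrict_le_self le_rfl

theorem stmt10 (μ : Measure ℝ) [IsProbabilityMeasure μ] (R : ℝ) (hR : 0 < R)
    (hsupp : μ (Set.Icc (-R) R)ᶜ = 0)
    (H : ℝ → ℝ) (hH : ∀ x, Gcdf μ R (H x) = Fcdf x) :
    ∀ x : ℝ, 2 * R ≤ x → x - R ≤ H x ∧ H x ≤ x + Kfun μ R x := by
  intro x hx2
  have hx : 0 < x := by linarith
  have hae : ∀ᵐ s ∂μ, s ∈ Set.Icc (-R) R := hsupp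
  have hres : μ.restrict (Set.Icc (-R) R) = μ := Measure.restrict_eq_self_of_ae_mem hae
  have hint : ∀ f : ℝ → ℝ, Continuous f → Integrable f μ := fun f hf => by
    have := hf.continuousOn.integrableOn_compact (μ := μ) (isCompact_Icc (a := -R) (b := R))
    rwa [IntegrableOn, hres] at this
  have hG : ∀ y, Gcdf μ R y = ∫ s, Fcdf (y - s) ∂μ := fun y => by rw [Gcdf_eq, hres]
  have hFc : ∀ y, Continuous fun s => Fcdf (y - s) := fun y =>
    Fcdf_cont.comp (continuous_const.sub continuous_id)
  constructor
  · have h1 : Fcdf x ≤ Fcdf (H x + R) := by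
      rw [← hH x, hG]
      calc ∫ s, Fcdf (H x - s) ∂μ ≤ ∫ s, Fcdf (H x + R) ∂μ := by
            refine integral_mono_ae (hint _ (hFc _)) (integrable_const _) ?_
            filter_upwards [hae] with s hs
            exact Fcdf_strictMono.monotone (by linarith [hs.1])
        _ = Fcdf (H x + R) := by simp
    have := Fcdf_strictMono.le_iff_le.1 h1
    linarith
  · by_contra hcon
    rw [not_le] at hcon
    set D := H x - x with hD
    have hDK : Kfun μ R x < D := by linarith
    have hL : Lam μ R x = ∫ s, Real.exp (x * s) ∂μ := by rw [Lam, hres]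
    have hec : Continuous fun s : ℝ => Real.exp (x * s) := by fun_prop
    have hLlow : Real.exp (-(x * R)) ≤ Lam μ R x := by
      rw [hL]
      calc Real.exp (-(x * R)) = ∫ s, Real.exp (-(x * R)) ∂μ := by simp
        _ ≤ _ := by
            refine integral_mono_ae (integrable_const _) (hint _ hec) ?_
            filter_upwards [hae] with s hs
            exact Real.exp_le_exp.2 (by nlinarith [hs.1])
    have hLpos : 0 < Lam μ R x := (Real.exp_pos _).trans_le hLlow
    have hlog : -(x * R) ≤ Real.log (Lam μ R x) := (Real.le_log_iff_exp_le hLpos).2 hLlow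
    have hKlow : -R + R / x ≤ Kfun μ R x := by
      rw [Kfun, le_div_iff₀ hx]
      have : (-R + R / x) * x = -(x * R) + R := by field_simp
      linarith
    have hQeq : Qtail x = ∫ s, Qtail (x + D - s) ∂μ := by
      simp only [Qtail]
      rw [integral_sub (integrable_const _) (hint _ (hFc _)), ← hG,
        show x + D = H x by rw [hD]; ring, hH]
      simp
    have hlt : Qtail x < Qtail x := by
      calc Qtail x = ∫ s, Qtail (x + D - s) ∂μ := hQeq
        _ ≤ ∫ s, (Qtail x * Real.exp (R - x * D)) * Real.exp (x * s) ∂μ := by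
            refine integral_mono_ae (hint _ (continuous_const.sub (hFc _)))
              (hint _ (continuous_const.mul hec)) ?_
            filter_upwards [hae] with s hs
            have := Q_key R x D s hR hx (by linarith) hs.2
            rw [mul_assoc, ← Real.exp_add]
            rw [show R - x * D + x * s = -x * (D - s) + R by ring]
            exact this
        _ = Qtail x * (Real.exp (R - x * D) * Lam μ R x) := by
            rw [integral_const_mul, hL, mul_assoc]
        _ < Qtail x * 1 := by
            refine mul_lt_mul_of_pos_left ?_ (Qtail_pos x)
            rw [← Real.exp_log hLpos, ← Real.exp_add, Real.exp_lt_one_iff]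
            rw [Kfun, div_lt_iff₀ hx] at hDK
            linarith
        _ = Qtail x := mul_one _
    exact lt_irrefl _ hlt
end
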